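/- Let A and B be disjoint nonempty sets, F_1 = F_{ξ1η1}[A] = (A*, R_1) and F_2 = F_{ξ2η2}[B] = (B*, R_2) tree frames (ξ_1, ξ_2 ∈ {i, r}, η_1, η_2 ∈ {n, t}). Then the bimodal logic of the Kripke 2-frame F_1 ⊗ F_2 equals the fusion Log(F_1) ⊗ Log(F_2). -/

import Mathlib

set_option autoImplicit false

/-- Modal formulas with `n` modalities (propositional letters indexed by `ℕ`). -/
inductive MFormula (n : ℕ) : Type
  | prop : ℕ → MFormula n
  | bot  : MFormula n
  | imp  : MFormula n → MFormula n → MFormula n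
  | box  : Fin n → MFormula n → MFormula n

namespace MFormula

/-- Negation as an abbreviation: ¬φ := φ → ⊥. -/
def neg {n : ℕ} (φ : MFormula n) : MFormula n := φ.imp .bot

/-- Uniform substitution of formulas for propositional letters. -/
def subst {n : ℕ} (s : ℕ → MFormula n) : MFormula n → MFormula n
  | prop p  => s p
  | bot     => bot
  | imp φ ψ => imp (φ.subst s) (ψ.subst s)
  | box i φ => box i (φ.subst s)

end MFormula

/-- A classical tautology: true under every boolean valuation of formulas
(a valuation respecting `⊥` and `→`, arbitrary on letters and boxed formulas). -/
def IsTautology {n : ℕ} (φ : MFormula n) : Prop :=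
  ∀ v : MFormula n → Prop,
    ¬ v .bot → (∀ ψ χ : MFormula n, v (ψ.imp χ) ↔ (v ψ → v χ)) → v φ

/-- Normal modal logics with `n` modalities. -/
structure IsNormalLogic {n : ℕ} (L : Set (MFormula n)) : Prop where
  taut : ∀ φ : MFormula n, IsTautology φ → φ ∈ L
  kax : ∀ (i : Fin n) (p q : MFormula n),
    ((MFormula.box i (p.imp q)).imp ((MFormula.box i p).imp (MFormula.box i q))) ∈ L
  mp : ∀ φ ψ : MFormula n, φ.imp ψ ∈ L → φ ∈ L → ψ ∈ L
  subst : ∀ (φ : MFormula n) (s : ℕ → MFormula n), φ ∈ L → φ.subst s ∈ L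
  nec : ∀ (i : Fin n) (φ : MFormula n), φ ∈ L → MFormula.box i φ ∈ L

/-- The smallest normal logic containing `Γ`. -/
def NormalClosure {n : ℕ} (Γ : Set (MFormula n)) : Set (MFormula n) :=
  ⋂₀ {L : Set (MFormula n) | IsNormalLogic L ∧ Γ ⊆ L}

/-- The axiom □p → ¬□¬p. -/
def dAx : MFormula 1 :=
  (MFormula.box 0 (.prop 0)).imp (MFormula.neg (MFormula.box 0 (MFormula.neg (.prop 0))))

/-- The axiom □p → p. -/
def tAx : MFormula 1 := (MFormula.box 0 (.prop 0)).imp (.prop 0)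

/-- The axiom □p → □□p. -/
def fourAx : MFormula 1 :=
  (MFormula.box 0 (.prop 0)).imp (MFormula.box 0 (MFormula.box 0 (.prop 0)))

def LogicK : Set (MFormula 1) := NormalClosure ∅
def LogicD : Set (MFormula 1) := NormalClosure (LogicK ∪ {dAx})
def LogicT : Set (MFormula 1) := NormalClosure (LogicK ∪ {tAx})
def LogicD4 : Set (MFormula 1) := NormalClosure (LogicD ∪ {fourAx})
def LogicS4 : Set (MFormula 1) := NormalClosure (LogicT ∪ {fourAx})

/-- Translation of a unimodal formula into the bimodal language, replacing □ by □_i. -/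
def trTo (i : Fin 2) : MFormula 1 → MFormula 2
  | .prop p  => .prop p
  | .bot     => .bot
  | .imp φ ψ => .imp (trTo i φ) (trTo i ψ)
  | .box _ φ => .box i (trTo i φ)

/-- The fusion `L₁ ⊗ L₂` of two unimodal logics: the smallest bimodal normal logic
containing the translation of `L₁` (□ ↦ □₁) and of `L₂` (□ ↦ □₂). -/
def Fusion (L₁ L₂ : Set (MFormula 1)) : Set (MFormula 2) :=
  NormalClosure (trTo 0 '' L₁ ∪ trTo 1 '' L₂)

/-- Truth in a Kripke model. -/
def kSat {n : ℕ} {W : Type} (R : Fin n → W → W → Prop) (V : ℕ → Set W) :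
    W → MFormula n → Prop
  | w, .prop p  => w ∈ V p
  | _, .bot     => False
  | w, .imp φ ψ => kSat R V w φ → kSat R V w ψ
  | w, .box i φ => ∀ v : W, R i w v → kSat R V v φ

/-- The logic of a Kripke `n`-frame. -/
def KLogn {n : ℕ} {W : Type} [Nonempty W] (R : Fin n → W → W → Prop) :
    Set (MFormula n) :=
  {φ | ∀ (V : ℕ → Set W) (w : W), kSat R V w φ}

/-- The logic of a unimodal Kripke frame. -/
def KLog {W : Type} [Nonempty W] (R : W → W → Prop) : Set (MFormula 1) :=
  KLogn (fun _ => R)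

/-- The logic of a bimodal Kripke frame. -/
def KLog2 {W : Type} [Nonempty W] (R₁ R₂ : W → W → Prop) : Set (MFormula 2) :=
  KLogn ![R₁, R₂]

/-- Truth in a (monotone) neighborhood model: `x ⊨ □_i φ` iff the truth set of `φ`
belongs to the filter `τ i x`. -/
def nSat {n : ℕ} {X : Type} (τ : Fin n → X → Filter X) (V : ℕ → Set X) :
    X → MFormula n → Prop
  | x, .prop p  => x ∈ V p
  | _, .bot     => False
  | x, .imp φ ψ => nSat τ V x φ → nSat τ V x ψ
  | x, .box i φ => {y | nSat τ V y φ} ∈ τ i x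

/-- The logic of a neighborhood `n`-frame. -/
def NLogn {n : ℕ} {X : Type} [Nonempty X] (τ : Fin n → X → Filter X) :
    Set (MFormula n) :=
  {φ | ∀ (V : ℕ → Set X) (x : X), nSat τ V x φ}

/-- The logic of a unimodal neighborhood frame. -/
def NLog {X : Type} [Nonempty X] (τ : X → Filter X) : Set (MFormula 1) :=
  NLogn (fun _ => τ)

/-- The logic of a neighborhood 2-frame. -/
def NLog2 {X : Type} [Nonempty X] (τ₁ τ₂ : X → Filter X) : Set (MFormula 2) :=
  NLogn ![τ₁, τ₂]

/-- Validity of a unimodal formula in a neighborhood frame. -/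
def NValid {X : Type} (τ : X → Filter X) (φ : MFormula 1) : Prop :=
  ∀ (V : ℕ → Set X) (x : X), nSat (fun _ => τ) V x φ

/-- The neighborhood frame `N(F)` of a Kripke frame `F = (W, R)`:
`τ(w)` is the principal filter of `R(w)`. -/
def nOfK {W : Type} (R : W → W → Prop) (w : W) : Filter W :=
  Filter.principal {v | R w v}

/-- Bounded morphisms between neighborhood frames (with neighborhood functions
indexed by `ι`). -/
def IsNdMorphism {ι X Y : Type} (τ : ι → X → Filter X) (σ : ι → Y → Filter Y)
    (f : X → Y) : Prop :=
  Function.Surjective f ∧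
    ∀ (i : ι) (x : X),
      (∀ U ∈ τ i x, f '' U ∈ σ i (f x)) ∧
      (∀ V ∈ σ i (f x), ∃ U ∈ τ i x, f '' U ⊆ V)

/-- First neighborhood function of the product of two neighborhood frames:
`U ∈ τ'_1(x₁,x₂)` iff `∃ V ∈ τ₁ x₁, V × {x₂} ⊆ U`. -/
def prodTau1 {X₁ X₂ : Type} (τ₁ : X₁ → Filter X₁) (p : X₁ × X₂) :
    Filter (X₁ × X₂) :=
  (τ₁ p.1).map (fun x => (x, p.2))

/-- Second neighborhood function of the product of two neighborhood frames:
`U ∈ τ'_2(x₁,x₂)` iff `∃ V ∈ τ₂ x₂, {x₁} × V ⊆ U`. -/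
def prodTau2 {X₁ X₂ : Type} (τ₂ : X₂ → Filter X₂) (p : X₁ × X₂) :
    Filter (X₁ × X₂) :=
  (τ₂ p.2).map (fun y => (p.1, y))

/-- The successor relation on finite sequences: `a R b` iff `b = a·x` for some `x ∈ A`. -/
def sucRel (A : Type) (a b : List A) : Prop := ∃ x : A, b = a ++ [x]

/-- The four kinds of tree frames: irreflexive/reflexive, non-transitive/transitive. -/
inductive TreeKind : Type
  | inn  -- irreflexive non-transitive: F_in
  | rn   -- reflexive non-transitive: F_rn (reflexive closure)
  | itr  -- irreflexive transitive: F_it (transitive closure)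
  | rt   -- reflexive transitive: F_rt (reflexive-transitive closure)

/-- The relation of the tree frame `F_{ξη}[A]` on `A*`. -/
def treeRel (A : Type) : TreeKind → List A → List A → Prop
  | .inn => sucRel A
  | .rn  => fun a b => a = b ∨ sucRel A a b
  | .itr => Relation.TransGen (sucRel A)
  | .rt  => Relation.ReflTransGen (sucRel A)

/-- First relation of the product frame `F₁ ⊗ F₂` on `(A ⊔ B)*`:
`x R'_1 y` iff `y = x·z` for some `z ∈ A*` with `Λ R₁ z`. -/
def prodRel1 (A B : Type) (k : TreeKind) (x y : List (A ⊕ B)) : Prop :=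
  ∃ z : List A, treeRel A k [] z ∧ y = x ++ z.map Sum.inl

/-- Second relation of the product frame `F₁ ⊗ F₂` on `(A ⊔ B)*`. -/
def prodRel2 (A B : Type) (k : TreeKind) (x y : List (A ⊕ B)) : Prop :=
  ∃ z : List B, treeRel B k [] z ∧ y = x ++ z.map Sum.inr

/-- Pseudo-infinite sequences over `A ∪ {0}` (with `0` modelled by `none`, so
automatically `0 ∉ A`) that are eventually `0`. -/
def PSeq (A : Type) : Type :=
  {α : ℕ → Option A // ∃ N, ∀ k ≥ N, α k = none}

instance {A : Type} : Nonempty (PSeq A) := ⟨⟨fun _ => none, 0, fun _ _ => rfl⟩⟩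

/-- `st(α)`: the least `N` such that `α` has only zeros from position `N` on. -/
noncomputable def PSeq.st {A : Type} (α : PSeq A) : ℕ :=
  sInf {N | ∀ k ≥ N, α.1 k = none}

/-- `f_F(α)`: the finite sequence obtained from `α` by deleting all zeros. -/
noncomputable def PSeq.forget {A : Type} (α : PSeq A) : List A :=
  ((List.range α.st).map α.1).reduceOption

/-- The basic neighborhood `U_k(α)` of `α`, relative to the relation `R` on `A*`:
`{β ∈ X : α|_m = β|_m and f_F(α) R f_F(β)}` where `m = max(k, st(α))`. -/
def Unbhd {A : Type} (R : List A → List A → Prop) (k : ℕ) (α : PSeq A) :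
    Set (PSeq A) :=
  {β | (∀ i < max k α.st, α.1 i = β.1 i) ∧ R α.forget β.forget}

/-- The neighborhood function of `N_ω(F)`: `τ(α)` is the filter generated by the
base `{U_k(α) : k ∈ ℕ}`. -/
noncomputable def nOmega {A : Type} (R : List A → List A → Prop) (α : PSeq A) :
    Filter (PSeq A) :=
  ⨅ k : ℕ, Filter.principal (Unbhd R k α)

/-- The interleaving `x₁ y₁ x₂ y₂ …` of two pseudo-infinite sequences. -/
def interleave {A B : Type} (α : PSeq A) (β : PSeq B) : PSeq (A ⊕ B) :=
  ⟨fun n => if n % 2 = 0 then (α.1 (n / 2)).map Sum.inl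
            else (β.1 (n / 2)).map Sum.inr, by
    obtain ⟨N₁, h₁⟩ := α.2
    obtain ⟨N₂, h₂⟩ := β.2
    refine ⟨2 * max N₁ N₂, fun k hk => ?_⟩
    have hdiv : max N₁ N₂ ≤ k / 2 := by omega
    by_cases h : k % 2 = 0
    · simp [h, h₁ (k / 2) (le_trans (le_max_left _ _) hdiv)]
    · simp [h, h₂ (k / 2) (le_trans (le_max_right _ _) hdiv)]⟩

/-- The map `g`: delete all zeros from the interleaving of `α` and `β`. -/
noncomputable def gMap {A B : Type} (p : PSeq A × PSeq B) : List (A ⊕ B) :=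
  (interleave p.1 p.2).forget

namespace FusionProof

/-! ### Tree relations -/

theorem rtg_iff {C : Type} (w u : List C) :
    Relation.ReflTransGen (sucRel C) w u ↔ ∃ y, u = w ++ y := by
  constructor
  · intro h
    induction h with
    | refl => exact ⟨[], by simp⟩
    | tail _ h ih =>
      obtain ⟨y, rfl⟩ := ih
      obtain ⟨x, rfl⟩ := h
      exact ⟨y ++ [x], by simp⟩
  · rintro ⟨y, rfl⟩
    induction y using List.reverseRecOn with
    | nil => simpa using Relation.ReflTransGen.refl
    | append_singleton y x ih => exact ih.tail ⟨x, by simp⟩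

theorem tg_iff {C : Type} (w u : List C) :
    Relation.TransGen (sucRel C) w u ↔ ∃ y, y ≠ [] ∧ u = w ++ y := by
  rw [Relation.TransGen.head'_iff]
  constructor
  · rintro ⟨c, ⟨x, rfl⟩, h⟩
    obtain ⟨y, rfl⟩ := (rtg_iff _ _).1 h
    exact ⟨x :: y, by simp, by simp⟩
  · rintro ⟨y, hy, rfl⟩
    cases y with
    | nil => exact absurd rfl hy
    | cons x y => exact ⟨w ++ [x], ⟨x, rfl⟩, (rtg_iff _ _).2 ⟨y, by simp⟩⟩

theorem treeRel_iff {C : Type} (k : TreeKind) (w u : List C) :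
    treeRel C k w u ↔ ∃ y, treeRel C k [] y ∧ u = w ++ y := by
  cases k with
  | inn => simp [treeRel, sucRel]
  | rn =>
    simp only [treeRel, sucRel]
    constructor
    · rintro (rfl | ⟨x, rfl⟩)
      · exact ⟨[], Or.inl rfl, by simp⟩
      · exact ⟨[x], Or.inr ⟨x, rfl⟩, rfl⟩
    · rintro ⟨y, (rfl | ⟨x, rfl⟩), rfl⟩
      · left; simp
      · right; exact ⟨x, rfl⟩
  | itr => simp [treeRel, tg_iff]
  | rt => simp [treeRel, rtg_iff]

/-! ### Normal logics -/

theorem normalClosure_normal {n : ℕ} (Γ : Set (MFormula n)) :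
    IsNormalLogic (NormalClosure Γ) where
  taut φ h := fun _ hL => hL.1.taut φ h
  kax i p q := fun _ hL => hL.1.kax i p q
  mp φ ψ h1 h2 := fun L hL => hL.1.mp φ ψ (h1 L hL) (h2 L hL)
  subst φ s h := fun L hL => hL.1.subst φ s (h L hL)
  nec i φ h := fun L hL => hL.1.nec i φ (h L hL)

theorem subset_normalClosure {n : ℕ} (Γ : Set (MFormula n)) : Γ ⊆ NormalClosure Γ :=
  fun _ h _ hL => hL.2 h

theorem kSat_subst {n : ℕ} {W : Type} (R : Fin n → W → W → Prop) (V : ℕ → Set W)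
    (s : ℕ → MFormula n) (φ : MFormula n) :
    ∀ w, kSat R V w (φ.subst s) ↔ kSat R (fun p => {w | kSat R V w (s p)}) w φ := by
  induction φ with
  | prop p => intro w; simp [MFormula.subst, kSat]
  | bot => intro w; simp [MFormula.subst, kSat]
  | imp a b iha ihb => intro w; simp [MFormula.subst, kSat, iha, ihb]
  | box i a ih => intro w; simp [MFormula.subst, kSat, ih]

theorem KLogn_normal {n : ℕ} {W : Type} [Nonempty W] (R : Fin n → W → W → Prop) :
    IsNormalLogic (KLogn R) where
  taut φ h := fun V w => h (kSat R V w) (by simp [kSat]) (by intros; simp [kSat])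
  kax i p q := fun V w => by
    simp only [kSat]
    exact fun h1 h2 v hv => h1 v hv (h2 v hv)
  mp φ ψ h1 h2 := fun V w => h1 V w (h2 V w)
  subst φ s h := fun V w => (kSat_subst R V s φ w).2 (h _ _)
  nec i φ h := fun V w v _ => h V v

theorem sat_tr {C W : Type} (i : Fin 2) (k : TreeKind) (R : Fin 2 → W → W → Prop)
    (f : List C → W)
    (hf : ∀ z v, R i (f z) v ↔ ∃ y, treeRel C k [] y ∧ v = f (z ++ y))
    (V : ℕ → Set W) (φ : MFormula 1) :
    ∀ z, kSat R V (f z) (trTo i φ) ↔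
      kSat (fun _ => treeRel C k) (fun p => {z | f z ∈ V p}) z φ := by
  induction φ with
  | prop p => intro w; simp [trTo, kSat]
  | bot => intro w; simp [trTo, kSat]
  | imp a b iha ihb => intro w; simp [trTo, kSat, iha, ihb]
  | box j a ih =>
    intro z
    simp only [trTo, kSat, hf]
    constructor
    · intro h v hv
      obtain ⟨y, hy, rfl⟩ := (treeRel_iff _ _ _).1 hv
      exact (ih _).1 (h _ ⟨y, hy, rfl⟩)
    · rintro h v ⟨y, hy, rfl⟩
      exact (ih _).2 (h _ ((treeRel_iff _ _ _).2 ⟨y, hy, rfl⟩))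

theorem fusion_sub (A B : Type) [Nonempty A] [Nonempty B] (k₁ k₂ : TreeKind) :
    Fusion (KLog (treeRel A k₁)) (KLog (treeRel B k₂)) ⊆
      KLog2 (prodRel1 A B k₁) (prodRel2 A B k₂) := by
  intro φ hφ
  refine hφ _ ⟨KLogn_normal _, ?_⟩
  rintro _ (⟨φ, h, rfl⟩ | ⟨φ, h, rfl⟩) V w
  · have := (sat_tr 0 k₁ ![prodRel1 A B k₁, prodRel2 A B k₂]
      (fun z => w ++ z.map Sum.inl) (by intro z v; simp [prodRel1]) V φ []).2 (h _ _)
    simpa using this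
  · have := (sat_tr 1 k₂ ![prodRel1 A B k₁, prodRel2 A B k₂]
      (fun z => w ++ z.map Sum.inr) (by intro z v; simp [prodRel2]) V φ []).2 (h _ _)
    simpa using this

/-! ### Surrogates -/

def enc : MFormula 2 → ℕ
  | .prop p => Nat.pair 0 p
  | .bot => Nat.pair 1 0
  | .imp a b => Nat.pair 2 (Nat.pair (enc a) (enc b))
  | .box i a => Nat.pair 3 (Nat.pair i (enc a))

theorem enc_inj : Function.Injective enc := by
  intro a
  induction a with
  | prop p => intro b h; cases b <;> simp_all [enc, Nat.pair_eq_pair]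
  | bot => intro b h; cases b <;> simp_all [enc, Nat.pair_eq_pair]
  | imp a b iha ihb =>
    intro c h
    cases c <;> simp only [enc, Nat.pair_eq_pair] at h <;> try omega
    rw [iha h.2.1, ihb h.2.2]
  | box i a ih =>
    intro c h
    cases c <;> simp only [enc, Nat.pair_eq_pair] at h <;> try omega
    rw [ih h.2.2, Fin.ext h.2.1]

instance : Nonempty (MFormula 2) := ⟨.bot⟩

noncomputable def dec : ℕ → MFormula 2 := Function.invFun enc

theorem dec_enc (a : MFormula 2) : dec (enc a) = a := Function.leftInverse_invFun enc_inj a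

def sur (i : Fin 2) : MFormula 2 → MFormula 1
  | .prop p => .prop (enc (.prop p))
  | .bot => .bot
  | .imp a b => .imp (sur i a) (sur i b)
  | .box j a => if j = i then .box 0 (sur i a) else .prop (enc (.box j a))

theorem subst_sur (i : Fin 2) (a : MFormula 2) : (trTo i (sur i a)).subst dec = a := by
  induction a with
  | prop p => simp [sur, trTo, MFormula.subst, dec_enc]
  | bot => rfl
  | imp a b iha ihb => simp [sur, trTo, MFormula.subst, iha, ihb]
  | box j a ih =>
    by_cases h : j = i
    · simp [sur, trTo, MFormula.subst, ih, h]
    · simp [sur, trTo, MFormula.subst, dec_enc, h]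

/-! ### Finite conjunctions -/

def conj : List (MFormula 2) → MFormula 2
  | [] => .imp .bot .bot
  | a :: l => MFormula.neg (a.imp (MFormula.neg (conj l)))

theorem val_conj (v : MFormula 2 → Prop) (h0 : ¬ v .bot)
    (h1 : ∀ ψ χ : MFormula 2, v (ψ.imp χ) ↔ (v ψ → v χ)) (l : List (MFormula 2)) :
    v (conj l) ↔ ∀ a ∈ l, v a := by
  induction l with
  | nil => simp [conj, h1]
  | cons a l ih => simp [conj, MFormula.neg, h1, h0, ih]

theorem conj_mem {L : Set (MFormula 2)} (hL : IsNormalLogic L) (l : List (MFormula 2))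
    (h : ∀ a ∈ l, a ∈ L) : conj l ∈ L := by
  induction l with
  | nil => exact hL.taut _ fun v h0 h1 => by simp [conj, h1]
  | cons a l ih =>
    have h2 : (a.imp ((conj l).imp (conj (a :: l)))) ∈ L :=
      hL.taut _ fun v h0 h1 => by
        simp only [h1, val_conj v h0 h1, List.mem_cons]
        rintro h3 h4 b (rfl | hb)
        · exact h3
        · exact h4 b hb
    exact hL.mp _ _ (hL.mp _ _ h2 (h a (by simp))) (ih fun b hb => h b (by simp [hb]))

open Classical in
noncomputable def lit (t : Set (MFormula 2)) (a : MFormula 2) : MFormula 2 :=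
  if a ∈ t then a else a.neg

noncomputable def char (S : List (MFormula 2)) (t : Set (MFormula 2)) : MFormula 2 :=
  conj (S.map (lit t))

theorem val_char (v : MFormula 2 → Prop) (h0 : ¬ v .bot)
    (h1 : ∀ ψ χ : MFormula 2, v (ψ.imp χ) ↔ (v ψ → v χ)) (S : List (MFormula 2))
    (t : Set (MFormula 2)) :
    v (char S t) ↔ ∀ a ∈ S, (v a ↔ a ∈ t) := by
  rw [char, val_conj v h0 h1]
  simp only [List.mem_map, forall_exists_index, and_imp, forall_apply_eq_imp_iff₂]
  refine forall₂_congr fun a _ => ?_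
  by_cases h : a ∈ t <;> simp [lit, h, MFormula.neg, h1, h0]

/-- Consistent types over `S`. -/
def Con (L : Set (MFormula 2)) (S : List (MFormula 2)) : Set (Set (MFormula 2)) :=
  {t | (∀ a ∈ t, a ∈ S) ∧ (char S t).neg ∉ L}

open Classical in
noncomputable def conF (L : Set (MFormula 2)) (S : List (MFormula 2)) : MFormula 2 :=
  conj ((S.sublists.filter fun l => (char S {a | a ∈ l}).neg ∈ L).map
    fun l => (char S {a | a ∈ l}).neg)

theorem conF_mem {L : Set (MFormula 2)} (hL : IsNormalLogic L) (S : List (MFormula 2)) :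
    conF L S ∈ L := by
  refine conj_mem hL _ fun a ha => ?_
  simp only [List.mem_map, List.mem_filter] at ha
  obtain ⟨l, ⟨_, h⟩, rfl⟩ := ha
  simpa using h

theorem val_conF (v : MFormula 2 → Prop) (h0 : ¬ v .bot)
    (h1 : ∀ ψ χ : MFormula 2, v (ψ.imp χ) ↔ (v ψ → v χ)) (L : Set (MFormula 2))
    (S : List (MFormula 2)) (h : v (conF L S)) : {a | a ∈ S ∧ v a} ∈ Con L S := by
  classical
  refine ⟨fun a ha => ha.1, fun hn => ?_⟩
  have e : {a | a ∈ S.filter (fun a => v a)} = {a | a ∈ S ∧ v a} := by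
    ext a; simp
  rw [conF, val_conj v h0 h1] at h
  have := h _ (List.mem_map.2 ⟨S.filter (fun a => v a), by
    simp only [List.mem_filter, List.mem_sublists, e]
    exact ⟨List.filter_sublist, by simpa using hn⟩, rfl⟩)
  rw [e, MFormula.neg, h1] at this
  exact h0 (this ((val_char v h0 h1 S _).2 fun a ha => by simp [ha]))

/-! ### Local models -/

structure Pre {C : Type} (i : Fin 2) (k : TreeKind) (S : List (MFormula 2))
    (l : List C → Set (MFormula 2)) (z : List C) : Prop where
  bot : MFormula.bot ∉ l z
  imp : ∀ a b : MFormula 2, a.imp b ∈ S → (a.imp b ∈ l z ↔ (a ∈ l z → b ∈ l z))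
  box : ∀ a, MFormula.box i a ∈ S →
    (MFormula.box i a ∈ l z ↔ ∀ y, treeRel C k [] y → a ∈ l (z ++ y))

structure Closed (S : List (MFormula 2)) : Prop where
  imp : ∀ a b : MFormula 2, a.imp b ∈ S → a ∈ S ∧ b ∈ S
  box : ∀ i a, MFormula.box i a ∈ S → a ∈ S

theorem exists_local {C : Type} (i : Fin 2) (k : TreeKind) {L : Set (MFormula 2)}
    (hL : IsNormalLogic L) (hC : trTo i '' KLog (treeRel C k) ⊆ L)
    (S : List (MFormula 2)) (hS : Closed S) (t : Set (MFormula 2)) (ht : t ∈ Con L S) :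
    ∃ l : List C → Set (MFormula 2), l [] = t ∧
      (∀ z, treeRel C k [] z → l z ∈ Con L S) ∧ ∀ z, Pre i k S l z := by
  set ψ : MFormula 2 := (MFormula.box i (conF L S)).imp (char S t).neg with hψ
  have h1 : ψ ∉ L := fun h => ht.2 (hL.mp _ _ h (hL.nec _ _ (conF_mem hL S)))
  have h2 : sur i ψ ∉ KLog (treeRel C k) := fun h => by
    have := hL.subst _ dec (hC ⟨_, h, rfl⟩)
    rw [subst_sur] at this
    exact h1 this
  simp only [KLog, KLogn, Set.mem_ofPred_eq, not_forall] at h2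
  obtain ⟨V, w, hw⟩ := h2
  set v : List C → MFormula 2 → Prop :=
    fun z a => kSat (fun _ => treeRel C k) V (w ++ z) (sur i a) with hv
  have v0 : ∀ z, ¬ v z .bot := fun z => by simp [hv, sur, kSat]
  have v1 : ∀ z (ψ χ : MFormula 2), v z (ψ.imp χ) ↔ (v z ψ → v z χ) :=
    fun z ψ χ => by simp [hv, sur, kSat]
  have v2 : ∀ z a, v z (.box i a) ↔ ∀ y, treeRel C k [] y → v (z ++ y) a := by
    intro z a
    simp only [hv, sur, kSat, if_true]
    constructor
    · intro h y hy
      exact h _ ((treeRel_iff _ _ _).2 ⟨y, hy, by simp⟩)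
    · intro h u hu
      obtain ⟨y, hy, rfl⟩ := (treeRel_iff _ _ _).1 hu
      simpa using h y hy
  have hw' : ¬ v [] ψ := by simpa [hv] using hw
  rw [hψ, MFormula.neg, v1, v1] at hw'
  have hw1 : v [] (.box i (conF L S)) := by tauto
  have hw2 : v [] (char S t) := by tauto
  rw [val_char _ (v0 _) (v1 _)] at hw2
  rw [v2] at hw1
  refine ⟨fun z => {a | a ∈ S ∧ v z a}, ?_, ?_, ?_⟩
  · ext a
    constructor
    · rintro ⟨h, h'⟩
      exact (hw2 a h).1 h'
    · intro h
      exact ⟨ht.1 a h, (hw2 a (ht.1 a h)).2 h⟩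
  · intro z hz
    exact val_conF _ (v0 z) (v1 z) L S (by simpa using hw1 z hz)
  · intro z
    refine ⟨fun h => v0 z h.2, fun a b h => ?_, fun a h => ?_⟩
    · have := hS.imp a b h
      simp [h, this, v1]
    · have := hS.box i a h
      simp [h, this, v2]

def Good {C : Type} (i : Fin 2) (k : TreeKind) (L : Set (MFormula 2)) (S : List (MFormula 2))
    (l : List C → Set (MFormula 2)) : Prop :=
  (∀ z, l z ∈ Con L S) ∧ ∀ z, Pre i k S l z

theorem good_of_short {C : Type} (i : Fin 2) (k : TreeKind) (L : Set (MFormula 2))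
    (S : List (MFormula 2)) (hk1 : ∀ x : C, treeRel C k [] [x])
    (hk2 : ∀ z : List C, treeRel C k [] z → z = [] ∨ ∃ x, z = [x])
    (H : ∀ t ∈ Con L S, ∃ l : List C → Set (MFormula 2), l [] = t ∧
      (∀ z, treeRel C k [] z → l z ∈ Con L S) ∧ ∀ z, Pre i k S l z)
    (t : Set (MFormula 2)) (ht : t ∈ Con L S) :
    ∃ l : List C → Set (MFormula 2), l [] = t ∧ Good i k L S l := by
  choose F F0 F1 F2 using H
  let step : Con L S → C → Con L S := fun t a => ⟨F t.1 t.2 [a], F1 _ _ _ (hk1 a)⟩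
  let lab : List C → Con L S := fun w => w.foldl step ⟨t, ht⟩
  have key : ∀ w y, treeRel C k [] y → (lab (w ++ y)).1 = F (lab w).1 (lab w).2 y := by
    intro w y hy
    rcases hk2 y hy with rfl | ⟨x, rfl⟩
    · rw [F0]; simp
    · simp [lab, step]
  refine ⟨fun w => (lab w).1, rfl, fun z => (lab z).2, fun z => ?_⟩
  have hp := F2 (lab z).1 (lab z).2 []
  have h0 := F0 (lab z).1 (lab z).2
  refine ⟨by simpa [h0] using hp.bot, fun a b h => by simpa [h0] using hp.imp a b h,
    fun a h => ?_⟩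
  have := hp.box a h
  rw [h0] at this
  rw [this]
  refine forall₂_congr fun y hy => ?_
  rw [key z y hy]; simp

theorem good_of_long {C : Type} (i : Fin 2) (k : TreeKind) (L : Set (MFormula 2))
    (S : List (MFormula 2)) (hk : ∀ z : List C, z ≠ [] → treeRel C k [] z)
    (H : ∀ t ∈ Con L S, ∃ l : List C → Set (MFormula 2), l [] = t ∧
      (∀ z, treeRel C k [] z → l z ∈ Con L S) ∧ ∀ z, Pre i k S l z)
    (t : Set (MFormula 2)) (ht : t ∈ Con L S) :
    ∃ l : List C → Set (MFormula 2), l [] = t ∧ Good i k L S l := by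
  obtain ⟨l, h0, h1, h2⟩ := H t ht
  refine ⟨l, h0, fun z => ?_, h2⟩
  by_cases hz : z = []
  · rw [hz, h0]; exact ht
  · exact h1 z (hk z hz)

theorem exists_good {C : Type} (i : Fin 2) (k : TreeKind) {L : Set (MFormula 2)}
    (hL : IsNormalLogic L) (hC : trTo i '' KLog (treeRel C k) ⊆ L)
    (S : List (MFormula 2)) (hS : Closed S) (t : Set (MFormula 2)) (ht : t ∈ Con L S) :
    ∃ l : List C → Set (MFormula 2), l [] = t ∧ Good i k L S l := by
  have H := exists_local i k hL hC S hS
  cases k with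
  | inn =>
    exact good_of_short (C := C) i .inn L S (fun x => ⟨x, rfl⟩)
      (fun z ⟨x, hx⟩ => Or.inr ⟨x, hx⟩) H t ht
  | rn =>
    refine good_of_short (C := C) i .rn L S (fun x => Or.inr ⟨x, rfl⟩) ?_ H t ht
    rintro z (rfl | ⟨x, hx⟩)
    · exact Or.inl rfl
    · exact Or.inr ⟨x, hx⟩
  | itr => exact good_of_long (C := C) i .itr L S (fun z hz => (tg_iff [] _).2 ⟨z, hz, rfl⟩) H t ht
  | rt => exact good_of_long (C := C) i .rt L S (fun z hz => (rtg_iff [] _).2 ⟨z, rfl⟩) H t ht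

theorem Good.shift {C : Type} {i : Fin 2} {k : TreeKind} {L : Set (MFormula 2)}
    {S : List (MFormula 2)} {l : List C → Set (MFormula 2)} (h : Good i k L S l) (a : C) :
    Good i k L S (fun z => l (a :: z)) :=
  ⟨fun z => h.1 _, fun z => ⟨(h.2 (a :: z)).bot, (h.2 (a :: z)).imp,
    fun b hb => (h.2 (a :: z)).box b hb⟩⟩

/-! ### Assembly -/

def sub : MFormula 2 → List (MFormula 2)
  | .prop p => [.prop p]
  | .bot => [.bot]
  | .imp a b => .imp a b :: (sub a ++ sub b)
  | .box i a => .box i a :: sub a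

theorem self_sub (a : MFormula 2) : a ∈ sub a := by cases a <;> simp [sub]

theorem sub_closed (φ : MFormula 2) : Closed (sub φ) := by
  induction φ with
  | prop p => exact ⟨by simp [sub], by simp [sub]⟩
  | bot => exact ⟨by simp [sub], by simp [sub]⟩
  | imp a b iha ihb =>
    constructor
    · intro c d h
      simp only [sub, List.mem_cons, List.mem_append, MFormula.imp.injEq] at h ⊢
      rcases h with ⟨rfl, rfl⟩ | h | h
      · simp [self_sub]
      · have := iha.imp _ _ h; tauto
      · have := ihb.imp _ _ h; tauto
    · intro i c h
      simp only [sub, List.mem_cons, List.mem_append, reduceCtorEq, false_or] at h ⊢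
      rcases h with h | h
      · have := iha.box _ _ h; tauto
      · have := ihb.box _ _ h; tauto
  | box j a ih =>
    constructor
    · intro c d h
      simp only [sub, List.mem_cons, reduceCtorEq, false_or] at h ⊢
      have := ih.imp _ _ h; tauto
    · intro i c h
      simp only [sub, List.mem_cons, MFormula.box.injEq] at h ⊢
      rcases h with ⟨rfl, rfl⟩ | h
      · simp [self_sub]
      · have := ih.box _ _ h; tauto

structure St (A B : Type) (k₁ k₂ : TreeKind) (L : Set (MFormula 2))
    (S : List (MFormula 2)) where
  l1 : List A → Set (MFormula 2)
  l2 : List B → Set (MFormula 2)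
  g1 : Good 0 k₁ L S l1
  g2 : Good 1 k₂ L S l2
  eq : l1 [] = l2 []

theorem complete (A B : Type) (k₁ k₂ : TreeKind) {L : Set (MFormula 2)}
    (hL : IsNormalLogic L) (hA : trTo 0 '' KLog (treeRel A k₁) ⊆ L)
    (hB : trTo 1 '' KLog (treeRel B k₂) ⊆ L) (φ : MFormula 2)
    (hφ : φ ∈ KLog2 (prodRel1 A B k₁) (prodRel2 A B k₂)) : φ ∈ L := by
  by_contra hn
  set S := sub φ with hS
  have hSc : Closed S := sub_closed φ
  -- a consistent type omitting `φ`
  obtain ⟨t, ht, hφt⟩ : ∃ t ∈ Con L S, φ ∉ t := by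
    by_contra hcon
    push Not at hcon
    refine hn (hL.mp _ _ (hL.taut _ fun v h0 h1 => ?_) (conF_mem hL S))
    rw [h1]
    intro h
    exact (hcon _ (val_conF v h0 h1 L S h)).2
  have GA := exists_good (C := A) 0 k₁ hL hA S hSc
  have GB := exists_good (C := B) 1 k₂ hL hB S hSc
  choose FA FA0 FAg using GA
  choose FB FB0 FBg using GB
  let step : St A B k₁ k₂ L S → A ⊕ B → St A B k₁ k₂ L S := fun s x =>
    match x with
    | .inl a => ⟨fun z => s.l1 (a :: z), FB _ (s.g1.1 [a]), s.g1.shift a, FBg _ _, (FB0 _ _).symm⟩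
    | .inr b => ⟨FA _ (s.g2.1 [b]), fun z => s.l2 (b :: z), FAg _ _, s.g2.shift b, FA0 _ _⟩
  let s0 : St A B k₁ k₂ L S := ⟨FA t ht, FB t ht, FAg _ _, FBg _ _, by rw [FA0, FB0]⟩
  have kA : ∀ (z : List A) (s : St A B k₁ k₂ L S),
      ((z.map Sum.inl).foldl step s).l1 [] = s.l1 z := by
    intro z
    induction z with
    | nil => intro s; rfl
    | cons a z ih => intro s; rw [List.map_cons, List.foldl_cons, ih]
  have kB : ∀ (z : List B) (s : St A B k₁ k₂ L S),
      ((z.map Sum.inr).foldl step s).l2 [] = s.l2 z := by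
    intro z
    induction z with
    | nil => intro s; rfl
    | cons a z ih => intro s; rw [List.map_cons, List.foldl_cons, ih]
  let st : List (A ⊕ B) → St A B k₁ k₂ L S := fun w => w.foldl step s0
  have sA : ∀ w z, (st (w ++ z.map Sum.inl)).l1 [] = (st w).l1 z := fun w z => by
    simp only [st, List.foldl_append]; exact kA z _
  have sB : ∀ w z, (st (w ++ z.map Sum.inr)).l1 [] = (st w).l2 z := fun w z => by
    rw [St.eq]; simp only [st, List.foldl_append]; exact kB z _
  have truth : ∀ a ∈ S, ∀ w, kSat ![prodRel1 A B k₁, prodRel2 A B k₂]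
      (fun p => {w | MFormula.prop p ∈ (st w).l1 []}) w a ↔ a ∈ (st w).l1 [] := by
    intro a
    induction a with
    | prop p => intro _ w; simp [kSat]
    | bot => intro _ w; simpa [kSat] using ((st w).g1.2 []).bot
    | imp a b iha ihb =>
      intro h w
      rw [((st w).g1.2 []).imp a b h, ← iha (hSc.imp _ _ h).1, ← ihb (hSc.imp _ _ h).2, kSat]
    | box i a ih =>
      intro h w
      have ih := ih (hSc.box _ _ h)
      rw [kSat]
      simp only [ih]
      match i, h with
      | 0, h =>
        rw [((st w).g1.2 []).box a h]
        constructor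
        · intro H y hy
          have := H (w ++ y.map Sum.inl) ⟨y, hy, rfl⟩
          rwa [sA] at this
        · rintro H v ⟨y, hy, rfl⟩
          rw [sA]; exact H y hy
      | 1, h =>
        rw [(st w).eq, ((st w).g2.2 []).box a h]
        constructor
        · intro H y hy
          have := H (w ++ y.map Sum.inr) ⟨y, hy, rfl⟩
          rwa [sB] at this
        · rintro H v ⟨y, hy, rfl⟩
          rw [sB]; exact H y hy
  have := (truth φ (self_sub φ) []).1 (hφ _ _)
  apply hφt
  have e : (st []).l1 [] = t := FA0 t ht
  rwa [e] at this

end FusionProof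

/-- The bimodal logic of the Kripke 2-frame `F₁ ⊗ F₂` (on `(A ⊔ B)*`)
is the fusion `Log(F₁) ⊗ Log(F₂)`. -/
theorem log_prodFrame_eq_fusion (A B : Type) [Nonempty A] [Nonempty B]
    (k₁ k₂ : TreeKind) :
    KLog2 (prodRel1 A B k₁) (prodRel2 A B k₂)
      = Fusion (KLog (treeRel A k₁)) (KLog (treeRel B k₂)) := by
  refine Set.Subset.antisymm (fun φ hφ => ?_) (FusionProof.fusion_sub A B k₁ k₂)
  exact FusionProof.complete A B k₁ k₂ (FusionProof.normalClosure_normal _)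
    (Set.subset_union_left.trans (FusionProof.subset_normalClosure _))
    (Set.subset_union_right.trans (FusionProof.subset_normalClosure _)) φ hφ
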